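/- Let (X,d,μ) be a compact space of homogeneous type with μ(B(x,t)) ≍ t^γ, G ⊆ X open, p > 1, δ = p/γ. Then for any compact K ⊆ G there is a constant c_p(K) such that for all f ∈ L¹_μ(X) with f restricted to G in L^p_μ(G): ‖ℒ_δ(𝒫₀f)‖_{L^p_μ(K)} ≤ c_p(K) ( ‖f‖_{L¹_μ(X)} + ‖f‖_{L^p_μ(G)} ). -/

import Mathlib

open MeasureTheory Set ENNReal

variable {X : Type*}

/-- Ball for a quasimetric `d`. -/
def qball (d : X → X → ℝ) (x : X) (t : ℝ) : Set X := {y | d x y < t}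

/-- Hardy–Littlewood maximal function: supremum of ball averages of `|f|` over
balls containing `x`. -/
noncomputable def HLmax [MeasurableSpace X] (d : X → X → ℝ) (μ : Measure X)
    (f : X → ℝ) (x : X) : ℝ≥0∞ :=
  ⨆ (y : X) (t : ℝ) (_ : 0 < t) (_ : x ∈ qball d y t),
    (μ (qball d y t))⁻¹ * ∫⁻ z in qball d y t, ENNReal.ofReal |f z| ∂μ

/-- `u(y,t)`: average of `|f|` over the ball `B(y,t)`. -/
noncomputable def ballAvg [MeasurableSpace X] (d : X → X → ℝ) (μ : Measure X)
    (f : X → ℝ) (y : X) (t : ℝ) : ℝ≥0∞ :=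
  (μ (qball d y t))⁻¹ * ∫⁻ z in qball d y t, ENNReal.ofReal |f z| ∂μ

/-- The operator `𝒫₀f(x,t)`. -/
noncomputable def P0 [MeasurableSpace X] (d : X → X → ℝ) (μ : MeasureTheory.Measure X) (γ : ℝ)
    (f : X → ℝ) (x : X) (t : ℝ) : ℝ≥0∞ :=
  (ENNReal.ofReal (Real.logb 2 (2 / t)))⁻¹ *
    ∫⁻ y, ENNReal.ofReal |f y| / ENNReal.ofReal ((d x y + t) ^ γ) ∂μ

/-- Tangential maximal operator `ℒ_δ`. -/
noncomputable def Ltan (d : X → X → ℝ) (δ : ℝ) (v : X → ℝ → ℝ≥0∞) (x : X) : ℝ≥0∞ :=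
  ⨆ (y : X) (t : ℝ) (_ : 0 < t) (_ : t < 1)
    (_ : d x y < t * (Real.logb 2 (2 / t)) ^ δ), v y t

/-- Parametric maximal operator `ℒ_{A,δ}` applied to the ball averages of `|f|`. -/
noncomputable def LAtan [MeasurableSpace X] (d : X → X → ℝ) (μ : MeasureTheory.Measure X)
    (A δ : ℝ) (f : X → ℝ) (x : X) : ℝ≥0∞ :=
  ⨆ (y : X) (t : ℝ) (_ : 0 < t)
    (_ : d x y < t * (Real.logb 2 (2 / t)) ^ δ)
    (_ : A < (Real.logb 2 (2 / t)) ^ δ),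
    (ENNReal.ofReal (Real.logb 2 (2 / t)))⁻¹ * ballAvg d μ f y (A * t)


noncomputable def Cgeo (q : ℝ) : ℝ≥0∞ := ∑' n : ℕ, (ENNReal.ofReal ((2:ℝ) ^ (-q))) ^ n

lemma Cgeo_ne_top (q : ℝ) (hq : 0 < q) : Cgeo q ≠ ⊤ := by
  unfold Cgeo
  rw [ENNReal.tsum_geometric]
  have h1 : (2:ℝ) ^ (-q) < 1 := Real.rpow_lt_one_of_one_lt_of_neg (by norm_num) (by linarith)
  have h2 : ENNReal.ofReal ((2:ℝ) ^ (-q)) < 1 := by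
    rw [← ENNReal.ofReal_one]
    exact (ENNReal.ofReal_lt_ofReal_iff (by norm_num)).2 h1
  exact ENNReal.inv_ne_top.2 (tsub_pos_of_lt h2).ne'

lemma geo_sum (q : ℝ) (hq : 0 < q) (W : ℕ → ℝ) (hmono : Monotone W)
    (D : Set (ℤ × ℕ)) (hD : ∀ a ∈ D, ∀ b ∈ D, a.2 < b.2 → a.1 < b.1) (Z : ℝ≥0∞)
    (hZ : ∀ a ∈ D, ENNReal.ofReal ((2:ℝ) ^ a.1 * W a.2) ≤ Z) :
    ∑' a : ℤ × ℕ, D.indicator (fun a => ENNReal.ofReal ((2:ℝ) ^ a.1 * W a.2) ^ q) a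
      ≤ Cgeo q * Z ^ q := by
  classical
  refine ENNReal.summable.tsum_le_of_sum_le ?_
  intro F
  have e1 : ∑ a ∈ F, D.indicator (fun a => ENNReal.ofReal ((2:ℝ) ^ a.1 * W a.2) ^ q) a
      = ∑ a ∈ F with a ∈ D, ENNReal.ofReal ((2:ℝ) ^ a.1 * W a.2) ^ q := by
    rw [Finset.sum_filter]
    exact Finset.sum_congr rfl fun a _ => by simp [Set.indicator_apply]
  rw [e1]
  set H := F.filter (· ∈ D) with hH
  have hHD : ∀ a ∈ H, a ∈ D := fun a ha => (Finset.mem_filter.1 ha).2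
  by_cases hne : H.Nonempty
  swap
  · rw [Finset.not_nonempty_iff_eq_empty.1 hne]; simp
  obtain ⟨b, hb, hmax⟩ := Finset.exists_max_image H (fun a => a.1) hne
  have key : ∀ a ∈ H, ENNReal.ofReal ((2:ℝ) ^ a.1 * W a.2) ^ q ≤
      (ENNReal.ofReal ((2:ℝ) ^ (-q))) ^ ((b.1 - a.1).toNat) * Z ^ q := by
    intro a ha
    set n := (b.1 - a.1).toNat with hn
    have hab : (n : ℤ) = b.1 - a.1 := Int.toNat_of_nonneg (by linarith [hmax a ha])
    have hjj : a.2 ≤ b.2 := by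
      by_contra h
      have := hD b (hHD b hb) a (hHD a ha) (not_le.1 h)
      linarith [hmax a ha]
    have hs : ENNReal.ofReal ((2:ℝ) ^ a.1 * W a.2) ≤ ENNReal.ofReal ((2:ℝ) ^ (-(n:ℝ))) * Z := by
      refine le_trans ?_ (mul_le_mul_right (hZ b (hHD b hb)) _)
      rw [← ENNReal.ofReal_mul (by positivity)]
      apply ENNReal.ofReal_le_ofReal
      have : a.1 = -(n:ℤ) + b.1 := by rw [hab]; ring
      have h2 : (2:ℝ) ^ (-(n:ℝ)) = (2:ℝ) ^ (-(n:ℤ)) := by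
        rw [← Real.rpow_intCast]; push_cast; rfl
      rw [h2, ← mul_assoc, ← zpow_add₀ (by norm_num : (2:ℝ) ≠ 0), ← this]
      exact mul_le_mul_of_nonneg_left (hmono hjj) (by positivity)
    refine (ENNReal.rpow_le_rpow hs hq.le).trans ?_
    rw [ENNReal.mul_rpow_of_nonneg _ _ hq.le]
    gcongr
    rw [ENNReal.ofReal_rpow_of_pos (by positivity), ← ENNReal.ofReal_pow (by positivity)]
    apply ENNReal.ofReal_le_ofReal
    rw [← Real.rpow_mul (by norm_num), ← Real.rpow_natCast, ← Real.rpow_mul (by norm_num)]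
    apply le_of_eq; congr 1; ring
  refine (Finset.sum_le_sum key).trans ?_
  rw [← Finset.sum_mul]
  gcongr
  have hinj : InjOn (fun a : ℤ × ℕ => (b.1 - a.1).toNat) H := by
    intro a ha a' ha' h
    have ha := Finset.mem_coe.1 ha
    have ha' := Finset.mem_coe.1 ha'
    have h1 := hmax a ha
    have h2 := hmax a' ha'
    have h3 : a.1 = a'.1 := by
      simp only at h h1 h2; omega
    have h4 : a.2 = a'.2 := by
      rcases lt_trichotomy a.2 a'.2 with h | h | h
      · have := hD a (hHD a ha) a' (hHD a' ha') h; omega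
      · exact h
      · have := hD a' (hHD a' ha') a (hHD a ha) h; omega
    exact Prod.ext h3 h4
  rw [← Finset.sum_image (f := fun n : ℕ => (ENNReal.ofReal ((2:ℝ) ^ (-q))) ^ n) hinj]
  exact ENNReal.sum_le_tsum _


lemma aux_zpow (x : ℝ) (hx : 0 < x) : ∃ n : ℤ, (2:ℝ) ^ n < x := by
  obtain ⟨n, hn⟩ := exists_mem_Ioc_zpow hx (by norm_num : (1:ℝ) < 2)
  exact ⟨n, hn.1⟩

noncomputable def Ccore (a γ c p : ℝ) : ℝ≥0∞ :=
  ENNReal.ofReal (2 ^ p * c * (3 * a ^ 2) ^ γ) * 2 * (Cgeo (p - 1) * ENNReal.ofReal (2 * c) ^ (p - 1))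

lemma Ccore_ne_top (a γ c p : ℝ) (hp : 1 < p) : Ccore a γ c p ≠ ⊤ := by
  unfold Ccore
  refine ENNReal.mul_ne_top (ENNReal.mul_ne_top ENNReal.ofReal_ne_top (by norm_num)) ?_
  exact ENNReal.mul_ne_top (Cgeo_ne_top _ (by linarith))
    (ENNReal.rpow_ne_top_of_nonneg (by linarith) ENNReal.ofReal_ne_top)

/-- Truncation: a set of large average keeps half of its mass on the high values. -/
lemma trunc_half [MeasurableSpace X] (ν : Measure X) (g : X → ℝ≥0∞)
    (E : Set X) (c s ρ : ℝ) (hc : 0 < c) (hs : 0 < s) (hρ : 0 < ρ)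
    (hE : ν E ≤ ENNReal.ofReal (c * ρ))
    (h : ENNReal.ofReal s * ENNReal.ofReal ρ < ∫⁻ z in E, g z ∂ν) :
    ENNReal.ofReal s * ENNReal.ofReal ρ ≤
      2 * ∫⁻ z in E, {z | ENNReal.ofReal s ≤ ENNReal.ofReal (2 * c) * g z}.indicator g z ∂ν := by
  set A := {z | ENNReal.ofReal s ≤ ENNReal.ofReal (2 * c) * g z} with hA
  have hpt : ∀ z, g z ≤ ENNReal.ofReal (s / (2 * c)) + A.indicator g z := by
    intro z
    by_cases hz : z ∈ A
    · simp [hz]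
    · have : ENNReal.ofReal (2 * c) * g z < ENNReal.ofReal s := not_le.1 hz
      refine le_trans ?_ le_self_add
      rw [ENNReal.ofReal_div_of_pos (by positivity)]
      rw [ENNReal.le_div_iff_mul_le (Or.inl (by simpa using hc)) (Or.inl ENNReal.ofReal_ne_top), mul_comm]
      exact this.le
  have h1 : ∫⁻ z in E, g z ∂ν ≤ ENNReal.ofReal (s * ρ / 2) + ∫⁻ z in E, A.indicator g z ∂ν := by
    calc ∫⁻ z in E, g z ∂ν ≤ ∫⁻ z in E, (ENNReal.ofReal (s / (2 * c)) + A.indicator g z) ∂ν :=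
          lintegral_mono hpt
      _ = ENNReal.ofReal (s / (2 * c)) * ν E + ∫⁻ z in E, A.indicator g z ∂ν := by
          rw [lintegral_add_left measurable_const]; simp
      _ ≤ _ := by
          gcongr
          calc _ ≤ ENNReal.ofReal (s / (2 * c)) * ENNReal.ofReal (c * ρ) := by gcongr
            _ = _ := by
              rw [← ENNReal.ofReal_mul (by positivity)]; congr 1; field_simp
  have h2 : ENNReal.ofReal s * ENNReal.ofReal ρ = ENNReal.ofReal (s * ρ / 2) + ENNReal.ofReal (s * ρ / 2) := by
    rw [← ENNReal.ofReal_mul hs.le, ← ENNReal.ofReal_add (by positivity) (by positivity)]; congr 1; ring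
  have h3 := h.le.trans h1
  rw [h2] at h3 ⊢
  have h4 := (ENNReal.add_le_add_iff_left ENNReal.ofReal_ne_top).1 h3
  rw [two_mul]
  exact add_le_add h4 h4

lemma core_finite [MeasurableSpace X] (d : X → X → ℝ) (a : ℝ) (ha : 1 ≤ a)
    (hself : ∀ x, d x x = 0)
    (hdsymm : ∀ x y, d x y = d y x)
    (hdtri : ∀ x y z, d x y ≤ a * (d x z + d z y))
    (μ ν : Measure X) (hν : ν ≤ μ) (γ c : ℝ) (hc : 0 < c)
    (hμ : ∀ (x : X) (t : ℝ), 0 < t → μ (qball d x t) ≤ ENNReal.ofReal (c * t ^ γ))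
    (p : ℝ) (hp : 1 < p) (g : X → ℝ≥0∞) (hgm : Measurable g) (hg : ∫⁻ z, g z ∂ν ≠ ⊤)
    (r R W : ℕ → ℝ) (hr : ∀ j, 0 < r j) (hW : ∀ j, 0 < W j) (hmono : Monotone W)
    (I : Set ℕ) (hI : ∃ J, ∀ j ∈ I, j ≤ J) (hrR : ∀ j ∈ I, r j ≤ R j) (C0 : ℝ) (hC00 : 0 < C0)
    (hC0 : ∀ j ∈ I, R j ^ γ ≤ C0 * W j ^ p * r j ^ γ)
    (hnest : ∀ j ∈ I, ∀ j' ∈ I, j < j' → a * R j' + a ^ 2 * (r j + r j') ≤ R j) :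
    ∃ Φ : X → ℝ≥0∞, Measurable Φ ∧
      ∫⁻ x, Φ x ∂μ ≤ Ccore a γ c p * ENNReal.ofReal C0 * ∫⁻ z, g z ^ p ∂ν ∧
      ∀ x, ∀ j ∈ I, ∀ y, ∀ E : Set X, MeasurableSet E → E ⊆ qball d y (r j) → d x y < R j →
        (∫⁻ z in E, g z ∂ν) ^ p ≤ Φ x * ENNReal.ofReal (W j * r j ^ γ) ^ p := by
  classical
  obtain ⟨J, hJ⟩ := hI
  set S : ℤ × ℕ → ℝ := fun b => (2:ℝ) ^ b.1 * W b.2 with hS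
  have hSpos : ∀ b, 0 < S b := fun b => mul_pos (by positivity) (hW _)
  have hρ : ∀ j, 0 < r j ^ γ := fun j => Real.rpow_pos_of_pos (hr j) _
  let Bad : ℤ → ℕ → X → Prop := fun m j y => ∃ E : Set X, MeasurableSet E ∧ E ⊆ qball d y (r j) ∧
    ENNReal.ofReal (S (m, j)) * ENNReal.ofReal (r j ^ γ) < ∫⁻ z in E, g z ∂ν
  let Good : ℤ → X → ℕ → Prop := fun m x j => ∃ y, d x y < R j ∧ Bad m j y
  let Sel : ℤ × ℕ → X → Prop := fun b x => b.2 ∈ I ∧ Good b.1 x b.2 ∧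
    (∀ m', (∃ j ∈ I, Good m' x j) → m' ≤ b.1) ∧ (∀ j' ∈ I, Good b.1 x j' → b.2 ≤ j')
  let Y : ℤ × ℕ → Set X := fun b => {y | Bad b.1 b.2 y ∧ ∃ x, Sel b x ∧ d x y < R b.2}
  have hvit : ∀ b, ∃ u ⊆ Y b, u.PairwiseDisjoint (fun y => qball d y (r b.2)) ∧
      ∀ y ∈ Y b, ∃ y' ∈ u, (qball d y (r b.2) ∩ qball d y' (r b.2)).Nonempty := by
    intro b
    obtain ⟨u, h1, h2, h3⟩ := Vitali.exists_disjoint_subfamily_covering_enlargement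
      (fun y => qball d y (r b.2)) (Y b) (fun _ => 1) 2 (by norm_num) (by simp) 1 (by simp)
      (fun y _ => ⟨y, by simp [qball, hself, hr]⟩)
    exact ⟨u, h1, h2, fun y hy => let ⟨y', h, h', _⟩ := h3 y hy; ⟨y', h, h'⟩⟩
  choose u huY hudisj hucov using hvit
  have hE : ∀ b y, ∃ E : Set X, MeasurableSet E ∧ (y ∈ Y b → E ⊆ qball d y (r b.2) ∧
    ENNReal.ofReal (S b) * ENNReal.ofReal (r b.2 ^ γ) < ∫⁻ z in E, g z ∂ν) := by
    intro b y
    by_cases hy : y ∈ Y b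
    · obtain ⟨⟨E, h1, h2, h3⟩, -⟩ := hy
      exact ⟨E, h1, fun _ => ⟨h2, h3⟩⟩
    · exact ⟨∅, MeasurableSet.empty, fun h => absurd h hy⟩
  choose E hEm hEp using hE
  have hEdisj : ∀ b, ∀ y ∈ u b, ∀ y' ∈ u b, ∀ z, z ∈ E b y → z ∈ E b y' → y = y' := by
    intro b y hy y' hy' z hz hz'
    by_contra hne
    exact Set.disjoint_left.1 (hudisj b hy hy' hne) ((hEp b y (huY b hy)).1 hz)
      ((hEp b y' (huY b hy')).1 hz')
  have hcount : ∀ b, Countable (u b) := by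
    intro b
    have : IsFiniteMeasure (ν.withDensity g) := isFiniteMeasure_withDensity hg
    have h := Measure.countable_meas_pos_of_disjoint_iUnion (μ := ν.withDensity g)
      (As := fun y : u b => E b y) (fun y => hEm b y) (by
        intro y y' hne
        refine Set.disjoint_left.2 fun z hz hz' => hne ?_
        exact Subtype.ext (hEdisj b y y.2 y' y'.2 z hz hz'))
    have h2 : {i : u b | 0 < (ν.withDensity g) (E b i)} = univ := by
      ext y
      simp only [Set.mem_ofPred_eq, mem_univ, iff_true]
      rw [withDensity_apply _ (hEm b y)]
      exact lt_of_le_of_lt zero_le (hEp b y (huY b y.2)).2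
    rw [h2] at h
    exact Set.countable_univ_iff.1 h
  -- main order property
  have horder : ∀ z, ∀ b b' : ℤ × ℕ, ∀ y ∈ u b, ∀ y' ∈ u b', z ∈ E b y → z ∈ E b' y' →
      b.2 < b'.2 → b.1 < b'.1 := by
    intro z b b' y hy y' hy' hz hz' hlt
    obtain ⟨hbad, x, hx, hxy⟩ := huY b hy
    obtain ⟨hbad', x', hx', hxy'⟩ := huY b' hy'
    have hzy : d y z < r b.2 := (hEp b y (huY b hy)).1 hz
    have hzy' : d y' z < r b'.2 := (hEp b' y' (huY b' hy')).1 hz'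
    have hb : b.2 ∈ I := hx.1
    have hb' : b'.2 ∈ I := hx'.1
    have h1 : d y' y ≤ a * (d y' z + d z y) := hdtri y' y z
    have h2 : d x' y ≤ a * (d x' y' + d y' y) := hdtri x' y y'
    have h3 : d z y < r b.2 := by rw [hdsymm]; exact hzy
    have hn := hnest _ hb _ hb' hlt
    have ha0 : 0 < a := by linarith
    have h4 : d y' y ≤ a * (r b.2 + r b'.2) :=
      h1.trans (mul_le_mul_of_nonneg_left (by linarith) ha0.le)
    have h5 : d x' y < R b.2 := by
      have : a * (d x' y' + d y' y) < a * (R b'.2 + a * (r b.2 + r b'.2)) :=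
        mul_lt_mul_of_pos_left (by linarith) ha0
      nlinarith
    have hgood : Good b.1 x' b.2 := ⟨y, h5, hbad⟩
    have hle := hx'.2.2.1 b.1 ⟨b.2, hb, hgood⟩
    rcases hle.lt_or_eq with h | h
    · exact h
    · exfalso
      have := hx'.2.2.2 b.2 hb (h ▸ hgood)
      omega
  -- the dominating function
  let K : (Σ b : ℤ × ℕ, u b) → Set X := fun i =>
    toMeasurable μ (qball d (i.2 : X) (3 * a ^ 2 * R i.1.2))
  let w : ℤ × ℕ → ℝ≥0∞ := fun b => ENNReal.ofReal ((2:ℝ) ^ (b.1 + 1)) ^ p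
  have hSelI : ∀ i : (Σ b : ℤ × ℕ, u b), i.1.2 ∈ I := fun i => by
    obtain ⟨-, x, hx, -⟩ := huY i.1 i.2.2
    exact hx.1
  have : ∀ b, Countable (u b) := hcount
  refine ⟨fun x => ∑' i, (K i).indicator (fun _ => w i.1) x, ?_, ?_, ?_⟩
  · exact Measurable.tsum fun i => measurable_const.indicator (measurableSet_toMeasurable _ _)
  · rw [lintegral_tsum fun i => (measurable_const.indicator (measurableSet_toMeasurable _ _)).aemeasurable]
    have hterm : ∀ i : (Σ b : ℤ × ℕ, u b), ∫⁻ x, (K i).indicator (fun _ => w i.1) x ∂μ ≤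
        ENNReal.ofReal (2 ^ p * c * (3 * a ^ 2) ^ γ) * ENNReal.ofReal C0 * 2 *
        ∫⁻ z, g z * (E i.1 i.2 ∩ {z | ENNReal.ofReal (S i.1) ≤ ENNReal.ofReal (2 * c) * g z}).indicator
          (fun _ => ENNReal.ofReal (S i.1) ^ (p - 1)) z ∂ν := by
      intro i
      set b := i.1 with hb
      obtain ⟨hEs, hEl⟩ := hEp b i.2 (huY b i.2.2)
      have hνE : ν (E b i.2) ≤ ENNReal.ofReal (c * r b.2 ^ γ) :=
        ((hν _).trans (measure_mono hEs)).trans (hμ _ _ (hr _))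
      have htr := trunc_half ν g (E b i.2) c (S b) (r b.2 ^ γ) hc (hSpos b) (hρ _) hνE hEl
      have hR : 0 < R b.2 := (hr _).trans_le (hrR _ (hSelI i))
      have h_integral : ∫⁻ z, g z * (E b i.2 ∩ {z | ENNReal.ofReal (S b) ≤ ENNReal.ofReal (2 * c) * g z}).indicator
          (fun _ => ENNReal.ofReal (S b) ^ (p - 1)) z ∂ν = ENNReal.ofReal (S b) ^ (p - 1) *
          ∫⁻ z in E b i.2, {z | ENNReal.ofReal (S b) ≤ ENNReal.ofReal (2 * c) * g z}.indicator g z ∂ν := by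
        rw [← lintegral_indicator (hEm _ _), ← lintegral_const_mul]
        · apply lintegral_congr
          intro z
          by_cases h1 : z ∈ E b i.2 <;>
          by_cases h2 : z ∈ {z | ENNReal.ofReal (S b) ≤ ENNReal.ofReal (2 * c) * g z} <;>
          simp only [Set.indicator_apply, Set.mem_inter_iff, h1, h2, if_true, if_false, mul_zero,
            and_self, and_true, and_false]
          exact mul_comm _ _
        · exact (hgm.indicator (measurableSet_le measurable_const (hgm.const_mul _))).indicator (hEm _ _)
      rw [h_integral, lintegral_indicator_const (measurableSet_toMeasurable _ _), measure_toMeasurable]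
      have hS2 : ENNReal.ofReal (S b) ^ (p - 1) * (ENNReal.ofReal (S b) * ENNReal.ofReal (r b.2 ^ γ))
          = ENNReal.ofReal (S b ^ p * r b.2 ^ γ) := by
        rw [ENNReal.ofReal_rpow_of_pos (hSpos b), ← ENNReal.ofReal_mul (hSpos b).le,
          ← ENNReal.ofReal_mul (Real.rpow_nonneg (hSpos b).le _), ← mul_assoc]
        congr 2
        rw [← Real.rpow_add_one (hSpos b).ne']
        congr 1; ring
      calc w b * μ (qball d (i.2 : X) (3 * a ^ 2 * R b.2))
          ≤ ENNReal.ofReal (((2:ℝ) ^ (b.1 + 1)) ^ p) * ENNReal.ofReal (c * (3 * a ^ 2 * R b.2) ^ γ) := by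
            refine mul_le_mul' (le_of_eq ?_) (hμ _ _ (by positivity))
            exact ENNReal.ofReal_rpow_of_pos (by positivity)
        _ ≤ ENNReal.ofReal (2 ^ p * c * (3 * a ^ 2) ^ γ) * ENNReal.ofReal C0 *
            ENNReal.ofReal (S b ^ p * r b.2 ^ γ) := by
            rw [← ENNReal.ofReal_mul (by positivity), ← ENNReal.ofReal_mul (by positivity),
              ← ENNReal.ofReal_mul (by positivity)]
            apply ENNReal.ofReal_le_ofReal
            have e1 : ((2:ℝ) ^ (b.1 + 1)) ^ p = 2 ^ p * ((2:ℝ) ^ b.1) ^ p := by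
              rw [zpow_add_one₀ (by norm_num), Real.mul_rpow (by positivity) (by norm_num), mul_comm]
            have e2 : S b ^ p = ((2:ℝ) ^ b.1) ^ p * W b.2 ^ p :=
              Real.mul_rpow (by positivity) (hW _).le
            have e3 : (3 * a ^ 2 * R b.2) ^ γ = (3 * a ^ 2) ^ γ * R b.2 ^ γ :=
              Real.mul_rpow (by positivity) hR.le
            rw [e1, e2, e3]
            calc 2 ^ p * ((2:ℝ) ^ b.1) ^ p * (c * ((3 * a ^ 2) ^ γ * R b.2 ^ γ))
                = (2 ^ p * ((2:ℝ) ^ b.1) ^ p * c * (3 * a ^ 2) ^ γ) * R b.2 ^ γ := by ring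
              _ ≤ (2 ^ p * ((2:ℝ) ^ b.1) ^ p * c * (3 * a ^ 2) ^ γ) * (C0 * W b.2 ^ p * r b.2 ^ γ) :=
                mul_le_mul_of_nonneg_left (hC0 _ (hSelI i)) (by positivity)
              _ = _ := by ring
        _ ≤ _ := by
            rw [← hS2, mul_assoc (_ * _) 2]
            refine mul_le_mul_right ((mul_le_mul_right htr _).trans (le_of_eq ?_)) _
            rw [← mul_assoc, ← mul_assoc, mul_comm (2 : ℝ≥0∞)]
    refine (ENNReal.tsum_le_tsum hterm).trans ?_
    rw [ENNReal.tsum_mul_left, ← lintegral_tsum]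
    swap
    · intro i
      refine (hgm.mul (measurable_const.indicator ((hEm _ _).inter ?_))).aemeasurable
      exact measurableSet_le measurable_const (hgm.const_mul _)
    have hpt : ∀ z, ∑' i : (Σ b : ℤ × ℕ, u b), g z * (E i.1 i.2 ∩ {z | ENNReal.ofReal (S i.1) ≤ ENNReal.ofReal (2 * c) * g z}).indicator
          (fun _ => ENNReal.ofReal (S i.1) ^ (p - 1)) z ≤
          (Cgeo (p - 1) * ENNReal.ofReal (2 * c) ^ (p - 1)) * g z ^ p := by
      intro z
      set D : Set (ℤ × ℕ) := {b | (∃ y ∈ u b, z ∈ E b y) ∧ ENNReal.ofReal (S b) ≤ ENNReal.ofReal (2 * c) * g z}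
        with hD
      have hgeo := geo_sum (p - 1) (by linarith) W hmono D (by
        rintro b ⟨⟨y, hy, hz⟩, -⟩ b' ⟨⟨y', hy', hz'⟩, -⟩ hlt
        exact horder z b b' y hy y' hy' hz hz' hlt) (ENNReal.ofReal (2 * c) * g z) (fun b hb => hb.2)
      rw [ENNReal.tsum_mul_left, ENNReal.tsum_sigma']
      have hin : ∀ b : ℤ × ℕ, ∑' y : u b, (E b y ∩ {z | ENNReal.ofReal (S b) ≤ ENNReal.ofReal (2 * c) * g z}).indicator
          (fun _ => ENNReal.ofReal (S b) ^ (p - 1)) z ≤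
          D.indicator (fun b => ENNReal.ofReal ((2:ℝ) ^ b.1 * W b.2) ^ (p - 1)) b := by
        intro b
        by_cases hbD : b ∈ D
        · obtain ⟨⟨y0, hy0, hz0⟩, h2⟩ := id hbD
          rw [tsum_eq_single (⟨y0, hy0⟩ : u b), Set.indicator_of_mem hbD]
          · exact Set.indicator_le_self' (fun _ _ => zero_le) _
          · intro y hne
            apply Set.indicator_of_notMem
            rintro ⟨hz, -⟩
            exact hne (Subtype.ext (hEdisj b y y.2 y0 hy0 z hz hz0))
        · rw [Set.indicator_of_notMem hbD]
          apply le_of_eq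
          rw [ENNReal.tsum_eq_zero]
          intro y
          apply Set.indicator_of_notMem
          rintro ⟨hz, h2⟩
          exact hbD ⟨⟨y, y.2, hz⟩, h2⟩
      calc g z * _ ≤ g z * (Cgeo (p - 1) * (ENNReal.ofReal (2 * c) * g z) ^ (p - 1)) :=
            mul_le_mul_right ((ENNReal.tsum_le_tsum hin).trans hgeo) _
        _ = _ := by
            have : g z ^ p = g z * g z ^ (p - 1) := by
              conv_lhs => rw [show p = 1 + (p - 1) by ring]
              rw [ENNReal.rpow_add_of_nonneg _ _ (by norm_num) (by linarith), ENNReal.rpow_one]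
            rw [ENNReal.mul_rpow_of_nonneg _ _ (by linarith), this]
            ring
    refine (mul_le_mul_right (lintegral_mono hpt) _).trans ?_
    rw [lintegral_const_mul _ (hgm.pow_const p)]
    unfold Ccore
    apply le_of_eq
    ring
  · intro x j hj y E' hE'm hE's hxy
    set v := ∫⁻ z in E', g z ∂ν with hv
    by_cases hv0 : v = 0
    · rw [hv0, ENNReal.zero_rpow_of_pos (by linarith)]; exact zero_le
    have hvt : v ≠ ⊤ := ne_top_of_le_ne_top hg (setLIntegral_le_lintegral _ _)
    have hv' : 0 < v.toReal := ENNReal.toReal_pos hv0 hvt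
    -- existence of a level
    have hex : ∃ m, ∃ j ∈ I, Good m x j := by
      obtain ⟨n, hn⟩ := aux_zpow (v.toReal / (W j * r j ^ γ))
        (div_pos hv' (mul_pos (hW _) (hρ _)))
      refine ⟨n, j, hj, y, hxy, E', hE'm, hE's, ?_⟩
      rw [← ENNReal.ofReal_mul (hSpos _).le, ← hv, ENNReal.ofReal_lt_iff_lt_toReal
        (mul_pos (hSpos _) (hρ _)).le hvt]
      rw [lt_div_iff₀ (mul_pos (hW _) (hρ _))] at hn
      simpa [hS, mul_assoc] using hn
    have hbd : ∃ B, ∀ m, (∃ j ∈ I, Good m x j) → m ≤ B := by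
      obtain ⟨j0, -, hj0⟩ := Finset.exists_min_image (Finset.range (J + 1)) (fun j => W j * r j ^ γ) ⟨0, by simp⟩
      have hq : 0 < W j0 * r j0 ^ γ := mul_pos (hW _) (hρ _)
      set G := (∫⁻ z, g z ∂ν).toReal with hG
      obtain ⟨n, hn⟩ := pow_unbounded_of_one_lt (G / (W j0 * r j0 ^ γ)) (by norm_num : (1:ℝ) < 2)
      refine ⟨n, ?_⟩
      rintro m ⟨j', hj', y', -, E'', -, -, hlt⟩
      have h1 := hlt.trans_le (setLIntegral_le_lintegral E'' g)
      rw [← ENNReal.ofReal_mul (hSpos _).le, ENNReal.ofReal_lt_iff_lt_toReal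
        (mul_pos (hSpos _) (hρ _)).le hg] at h1
      have h2 := hj0 j' (by simpa [Nat.lt_succ_iff] using hJ j' hj')
      have h3 : (2:ℝ) ^ m * (W j0 * r j0 ^ γ) < G := by
        refine lt_of_le_of_lt ?_ h1
        simp only [hS, mul_assoc]
        exact mul_le_mul_of_nonneg_left h2 (by positivity)
      rw [← lt_div_iff₀ hq] at h3
      have h4 := h3.trans hn
      rw [← zpow_natCast] at h4
      exact ((zpow_lt_zpow_iff_right₀ (by norm_num)).1 h4).le
    obtain ⟨m, ⟨j1, hj1, hg1⟩, hmax⟩ := Int.exists_greatest_of_bdd hbd hex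
    have hexj : ∃ j, j ∈ I ∧ Good m x j := ⟨j1, hj1, hg1⟩
    set jm := Nat.find hexj with hjm
    have hspec : jm ∈ I ∧ Good m x jm := Nat.find_spec hexj
    have hsel : Sel (m, jm) x := ⟨hspec.1, hspec.2, hmax, fun j' h h' => Nat.find_min' hexj ⟨h, h'⟩⟩
    obtain ⟨y', hxy', hbad'⟩ := hspec.2
    obtain ⟨y'', hy'', q, hq1, hq2⟩ := hucov (m, jm) y' ⟨hbad', x, hsel, hxy'⟩
    have hxK : x ∈ K ⟨(m, jm), ⟨y'', hy''⟩⟩ := by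
      apply subset_toMeasurable
      change d y'' x < 3 * a ^ 2 * R jm
      have hq1 : d y' q < r jm := hq1
      have hq2 : d y'' q < r jm := hq2
      have h1 := hdtri y'' x y'
      have h2 := hdtri y'' y' q
      have h3 := hrR jm hspec.1
      have h4 := hr jm
      rw [hdsymm q y'] at h2
      rw [hdsymm y' x] at h1
      have ha0 : 0 < a := by linarith
      have h5 : d y'' y' ≤ a * (2 * R jm) := h2.trans (mul_le_mul_of_nonneg_left (by linarith) ha0.le)
      have h6 : a * (d y'' y' + d x y') < a * (a * (2 * R jm) + R jm) :=
        mul_lt_mul_of_pos_left (by linarith) ha0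
      have h7 : a * R jm ≤ a ^ 2 * R jm := by
        apply mul_le_mul_of_nonneg_right _ (by linarith); nlinarith
      nlinarith
    have hvle : v ≤ ENNReal.ofReal ((2:ℝ) ^ (m + 1)) * ENNReal.ofReal (W j * r j ^ γ) := by
      by_contra hcon
      have : m + 1 ≤ m := by
        refine hmax (m + 1) ⟨j, hj, y, hxy, E', hE'm, hE's, ?_⟩
        refine lt_of_eq_of_lt ?_ (not_le.1 hcon)
        rw [← ENNReal.ofReal_mul (hSpos _).le, ← ENNReal.ofReal_mul (by positivity)]
        simp [hS, mul_assoc]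
      omega
    refine (ENNReal.rpow_le_rpow hvle (by linarith)).trans ?_
    rw [ENNReal.mul_rpow_of_nonneg _ _ (by linarith)]
    gcongr
    refine le_trans ?_ (ENNReal.le_tsum (⟨(m, jm), ⟨y'', hy''⟩⟩ : (Σ b : ℤ × ℕ, u b)))
    rw [Set.indicator_of_mem hxK]

lemma core [MeasurableSpace X] (d : X → X → ℝ) (a : ℝ) (ha : 1 ≤ a)
    (hself : ∀ x, d x x = 0)
    (hdsymm : ∀ x y, d x y = d y x)
    (hdtri : ∀ x y z, d x y ≤ a * (d x z + d z y))
    (μ ν : Measure X) (hν : ν ≤ μ) (γ c : ℝ) (hc : 0 < c)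
    (hμ : ∀ (x : X) (t : ℝ), 0 < t → μ (qball d x t) ≤ ENNReal.ofReal (c * t ^ γ))
    (p : ℝ) (hp : 1 < p) (g : X → ℝ≥0∞) (hgm : Measurable g) (hg : ∫⁻ z, g z ∂ν ≠ ⊤)
    (r R W : ℕ → ℝ) (hr : ∀ j, 0 < r j) (hW : ∀ j, 0 < W j) (hmono : Monotone W)
    (I : Set ℕ) (hrR : ∀ j ∈ I, r j ≤ R j) (C0 : ℝ) (hC00 : 0 < C0)
    (hC0 : ∀ j ∈ I, R j ^ γ ≤ C0 * W j ^ p * r j ^ γ)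
    (hnest : ∀ j ∈ I, ∀ j' ∈ I, j < j' → a * R j' + a ^ 2 * (r j + r j') ≤ R j) :
    ∃ Φ : X → ℝ≥0∞, Measurable Φ ∧
      ∫⁻ x, Φ x ∂μ ≤ Ccore a γ c p * ENNReal.ofReal C0 * ∫⁻ z, g z ^ p ∂ν ∧
      ∀ x, ∀ j ∈ I, ∀ y, ∀ E : Set X, MeasurableSet E → E ⊆ qball d y (r j) → d x y < R j →
        ENNReal.ofReal ((r j) ^ (-γ)) * (∫⁻ z in E, g z ∂ν) ≤ ENNReal.ofReal (W j) * Φ x ^ (1 / p) := by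
  have hfin := fun J : ℕ => core_finite d a ha hself hdsymm hdtri μ ν hν γ c hc hμ p hp g hgm hg r R W
    hr hW hmono (I ∩ {j | j ≤ J}) ⟨J, fun j hj => hj.2⟩ (fun j hj => hrR j hj.1) C0 hC00
    (fun j hj => hC0 j hj.1) (fun j hj j' hj' h => hnest j hj.1 j' hj'.1 h)
  choose Φ hΦm hΦi hΦ using hfin
  refine ⟨fun x => Filter.liminf (fun J => Φ J x) Filter.atTop, Measurable.liminf hΦm, ?_, ?_⟩
  · refine (lintegral_liminf_le hΦm).trans ?_
    refine Filter.liminf_le_of_le (by isBoundedDefault) ?_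
    intro B hB
    obtain ⟨J, hJ⟩ := hB.exists
    exact hJ.trans (hΦi J)
  · intro x j hj y E hE hEs hxy
    have hp0 : 0 < p := by linarith
    set v := ∫⁻ z in E, g z ∂ν with hv
    have hρ : 0 < r j ^ γ := Real.rpow_pos_of_pos (hr j) _
    have hWρ : 0 < W j * r j ^ γ := mul_pos (hW j) hρ
    have h1 : (v / ENNReal.ofReal (W j * r j ^ γ)) ^ p ≤ Filter.liminf (fun J => Φ J x) Filter.atTop := by
      refine Filter.le_liminf_of_le (by isBoundedDefault) ?_
      filter_upwards [Filter.eventually_ge_atTop j] with J hJ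
      have := hΦ J x j ⟨hj, hJ⟩ y E hE hEs hxy
      rw [ENNReal.div_rpow_of_nonneg _ _ hp0.le]
      exact ENNReal.div_le_of_le_mul this
    have h2 : v / ENNReal.ofReal (W j * r j ^ γ) ≤
        (Filter.liminf (fun J => Φ J x) Filter.atTop) ^ (1 / p) := by
      rw [one_div, ENNReal.le_rpow_inv_iff hp0]
      exact h1
    calc ENNReal.ofReal ((r j) ^ (-γ)) * v
        = ENNReal.ofReal (W j) * (v / ENNReal.ofReal (W j * r j ^ γ)) := by
          rw [ENNReal.div_eq_inv_mul, ← ENNReal.ofReal_inv_of_pos hWρ, ← mul_assoc,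
            ← ENNReal.ofReal_mul (hW j).le]
          congr 2
          rw [Real.rpow_neg (hr j).le]
          field_simp [(hW j).ne']
      _ ≤ _ := mul_le_mul_right h2 _

lemma kernel_le (s D γ : ℝ) (hγ : 0 < γ) (hs : 0 < s) (h : s ≤ D) (v : ℝ≥0∞) :
    v / ENNReal.ofReal (D ^ γ) ≤ ENNReal.ofReal (s ^ (-γ)) * v := by
  have h1 : s ^ γ ≤ D ^ γ := Real.rpow_le_rpow hs.le h hγ.le
  have h2 : 0 < s ^ γ := Real.rpow_pos_of_pos hs _
  rw [ENNReal.div_eq_inv_mul, ← ENNReal.ofReal_inv_of_pos (h2.trans_le h1)]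
  gcongr
  rw [Real.rpow_neg hs.le]
  gcongr

lemma kernel_decomp [MeasurableSpace X] (d : X → X → ℝ) (hd : ∀ x y, 0 ≤ d x y)
    (μ : Measure X) (γ : ℝ) (hγ : 0 < γ) (g : X → ℝ≥0∞) (hgm : Measurable g)
    (b : ℝ) (hb : 1 < b) (j i0 : ℕ) (hij : i0 ≤ j) (y : X) (t : ℝ)
    (ht : b ^ (-(j:ℤ) - 1) ≤ t) :
    ∃ E : ℕ → Set X, (∀ k, MeasurableSet (E k)) ∧ (∀ k, E k ⊆ qball d y (b ^ ((k:ℤ) - j))) ∧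
      ∫⁻ z, g z / ENNReal.ofReal ((d y z + t) ^ γ) ∂μ ≤
        ENNReal.ofReal ((b ^ (-(i0:ℤ))) ^ (-γ)) * ∫⁻ z, g z ∂μ +
        ENNReal.ofReal (b ^ γ) * ∑ k ∈ Finset.range (j - i0 + 1),
          ENNReal.ofReal ((b ^ ((k:ℤ) - j)) ^ (-γ)) * ∫⁻ z in E k, g z ∂μ := by
  classical
  obtain ⟨h, hhm, hhle, hheq⟩ := exists_measurable_le_lintegral_eq μ
    (fun z => g z / ENNReal.ofReal ((d y z + t) ^ γ))
  have hb0 : 0 < b := by linarith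
  have hρ : ∀ k : ℤ, 0 < b ^ k := fun k => zpow_pos hb0 _
  have htp : 0 < t := (hρ _).trans_le ht
  let E : ℕ → Set X := fun k => {z | ENNReal.ofReal ((b ^ ((k:ℤ) - j)) ^ (-γ)) * g z < h z}
  have hEm : ∀ k, MeasurableSet (E k) := fun k => measurableSet_lt (hgm.const_mul _) hhm
  refine ⟨E, hEm, ?_, ?_⟩
  · intro k z hz
    by_contra hcon
    have hcon : b ^ ((k:ℤ) - j) ≤ d y z := not_lt.1 hcon
    have h1 := (hhle z).trans (kernel_le _ (d y z + t) γ hγ (hρ _) (by linarith) (g z))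
    exact absurd hz (not_lt.2 h1)
  · rw [hheq]
    have hstep : ∀ k : ℤ, ENNReal.ofReal (b ^ γ) * ENNReal.ofReal ((b ^ k) ^ (-γ)) =
        ENNReal.ofReal ((b ^ (k - 1)) ^ (-γ)) := by
      intro k
      rw [← ENNReal.ofReal_mul (by positivity)]
      congr 1
      rw [zpow_sub_one₀ hb0.ne', Real.mul_rpow (hρ k).le (by positivity), Real.inv_rpow hb0.le,
        Real.rpow_neg hb0.le, inv_inv, mul_comm]
    have hpt : ∀ z, h z ≤ ENNReal.ofReal ((b ^ (-(i0:ℤ))) ^ (-γ)) * g z +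
        ∑ k ∈ Finset.range (j - i0 + 1), ENNReal.ofReal (b ^ γ) * (ENNReal.ofReal ((b ^ ((k:ℤ) - j)) ^ (-γ)) *
          (E k).indicator g z) := by
      intro z
      by_cases hex : ∃ k, k ∈ Finset.range (j - i0 + 1) ∧ z ∈ E k
      · obtain ⟨hk1, hk2⟩ := Nat.find_spec hex
        set k := Nat.find hex with hk
        refine le_trans ?_ le_add_self
        refine le_trans ?_ (Finset.single_le_sum (fun _ _ => zero_le) hk1)
        rw [Set.indicator_of_mem hk2, ← mul_assoc, hstep]
        rcases Nat.eq_zero_or_pos k with h0 | h0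
        · refine (hhle z).trans (kernel_le _ (d y z + t) γ hγ (hρ _) ?_ (g z))
          rw [h0]
          simp only [Nat.cast_zero, zero_sub]
          linarith [hd y z]
        · have hnot := Nat.find_min hex (m := k - 1) (by omega)
          have hnE : z ∉ E (k - 1) := fun hz => hnot ⟨by
            simp only [Finset.mem_range] at hk1 ⊢; omega, hz⟩
          have this : h z ≤ ENNReal.ofReal ((b ^ (((k - 1 : ℕ) : ℤ) - j)) ^ (-γ)) * g z := not_lt.1 hnE
          rw [show (((k - 1 : ℕ) : ℤ) - j) = (k:ℤ) - j - 1 by omega] at this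
          exact this
      · push Not at hex
        refine le_trans ?_ le_self_add
        have this : h z ≤ ENNReal.ofReal ((b ^ (((j - i0 : ℕ) : ℤ) - j)) ^ (-γ)) * g z :=
          not_lt.1 (hex (j - i0) (by simp))
        rw [show (((j - i0 : ℕ) : ℤ) - j) = -(i0:ℤ) by omega] at this
        exact this
    refine (lintegral_mono hpt).trans (le_of_eq ?_)
    rw [lintegral_add_left (hgm.const_mul _), lintegral_const_mul _ hgm, lintegral_finsetSum]
    · rw [Finset.mul_sum]
      congr 1
      refine Finset.sum_congr rfl fun k _ => ?_
      have hm : Measurable ((E k).indicator g) := hgm.indicator (hEm k)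
      rw [lintegral_const_mul _ (hm.const_mul _), lintegral_const_mul _ hm, lintegral_indicator (hEm k)]
    · intro k _
      exact ((hgm.indicator (hEm k)).const_mul _).const_mul _

lemma sum_dom [MeasurableSpace X] (μ : Measure X) (p : ℝ) (hp : 1 < p) (β : ℝ) (hβ0 : 0 < β)
    (hβ1 : β < 1) : ∃ C : ℝ≥0∞, C ≠ ⊤ ∧ ∀ (Φ : ℕ → X → ℝ≥0∞) (A : ℝ≥0∞), (∀ k, Measurable (Φ k)) →
      (∀ k, ∫⁻ x, Φ k x ∂μ ≤ A * ENNReal.ofReal (β ^ k)) →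
      ∫⁻ x, (∑' k, Φ k x ^ (1 / p)) ^ p ∂μ ≤ C * A := by
  have hp0 : 0 < p := by linarith
  -- θ is the geometric ratio, η its p-th power
  set η : ℝ := β ^ (1 / 2 : ℝ) with hη
  have hη0 : 0 < η := Real.rpow_pos_of_pos hβ0 _
  have hη1 : η < 1 := Real.rpow_lt_one hβ0.le hβ1 (by norm_num)
  have hηη : η * η = β := by rw [hη, ← Real.rpow_add hβ0]; norm_num
  set θ : ℝ := η ^ (1 / p) with hθ
  have hθ0 : 0 < θ := Real.rpow_pos_of_pos hη0 _
  have hθ1 : θ < 1 := Real.rpow_lt_one hη0.le hη1 (by positivity)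
  have geo : ∀ q : ℝ, 0 < q → q < 1 → ∑' k : ℕ, ENNReal.ofReal q ^ k ≠ ⊤ := by
    intro q h0 h1
    rw [ENNReal.tsum_geometric]
    refine ENNReal.inv_ne_top.2 (tsub_pos_of_lt ?_).ne'
    rw [← ENNReal.ofReal_one]
    exact (ENNReal.ofReal_lt_ofReal_iff (by norm_num)).2 h1
  refine ⟨(∑' k : ℕ, ENNReal.ofReal θ ^ k) ^ p * ∑' k : ℕ, ENNReal.ofReal η ^ k,
    ENNReal.mul_ne_top (ENNReal.rpow_ne_top_of_nonneg hp0.le (geo θ hθ0 hθ1)) (geo η hη0 hη1), ?_⟩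
  intro Φ A hm hi
  set Q : X → ℝ≥0∞ := fun x => ∑' k, ENNReal.ofReal (η⁻¹ ^ k) * Φ k x with hQ
  have hpt : ∀ x, (∑' k, Φ k x ^ (1 / p)) ^ p ≤ (∑' k : ℕ, ENNReal.ofReal θ ^ k) ^ p * Q x := by
    intro x
    have h1 : ∀ k, Φ k x ^ (1 / p) ≤ ENNReal.ofReal θ ^ k * Q x ^ (1 / p) := by
      intro k
      have h2 : Φ k x ≤ ENNReal.ofReal (η ^ k) * Q x := by
        calc Φ k x = ENNReal.ofReal (η ^ k) * (ENNReal.ofReal (η⁻¹ ^ k) * Φ k x) := by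
              rw [← mul_assoc, ← ENNReal.ofReal_mul (by positivity), ← mul_pow,
                mul_inv_cancel₀ hη0.ne']; simp
          _ ≤ _ := mul_le_mul_right (ENNReal.le_tsum k) _
      refine (ENNReal.rpow_le_rpow h2 (by positivity)).trans (le_of_eq ?_)
      rw [ENNReal.mul_rpow_of_nonneg _ _ (by positivity), ENNReal.ofReal_rpow_of_pos (by positivity),
        ← ENNReal.ofReal_pow hθ0.le]
      congr 2
      rw [hθ, ← Real.rpow_natCast, ← Real.rpow_natCast, ← Real.rpow_mul hη0.le, ← Real.rpow_mul hη0.le,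
        mul_comm]
    refine (ENNReal.rpow_le_rpow (ENNReal.tsum_le_tsum h1) hp0.le).trans (le_of_eq ?_)
    rw [ENNReal.tsum_mul_right, ENNReal.mul_rpow_of_nonneg _ _ hp0.le, ← ENNReal.rpow_mul,
      one_div_mul_cancel hp0.ne', ENNReal.rpow_one]
  refine (lintegral_mono hpt).trans ?_
  have hQm : ∀ k, Measurable fun x => ENNReal.ofReal (η⁻¹ ^ k) * Φ k x := fun k => (hm k).const_mul _
  rw [lintegral_const_mul _ (Measurable.tsum hQm), mul_assoc,
    lintegral_tsum fun k => (hQm k).aemeasurable]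
  refine mul_le_mul_right ?_ _
  rw [← ENNReal.tsum_mul_right]
  refine ENNReal.tsum_le_tsum fun k => ?_
  rw [lintegral_const_mul _ (hm k)]
  refine (mul_le_mul_right (hi k) _).trans (le_of_eq ?_)
  rw [mul_comm A, ← mul_assoc, ← ENNReal.ofReal_mul (by positivity), ← ENNReal.ofReal_pow hη0.le,
    ← hηη, ← mul_pow]
  congr 3
  field_simp

lemma R_step (δ a b : ℝ) (hδ : 0 < δ) (ha : 1 ≤ a) (hb : b = 4 * a * 2 ^ δ) (C1 : ℝ) (hC1 : 0 < C1)
    (j j' : ℕ) (h : j < j') :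
    a * (C1 * b ^ (-(j':ℤ)) * ((j':ℝ) + 1) ^ δ) ≤ C1 * b ^ (-(j:ℤ)) * ((j:ℝ) + 1) ^ δ / 4 := by
  have h2δ : 0 < (2:ℝ) ^ δ := by positivity
  have hb0 : 0 < b := by rw [hb]; positivity
  have step : ∀ n : ℕ, a * (C1 * b ^ (-((n + 1 : ℕ):ℤ)) * (((n + 1 : ℕ):ℝ) + 1) ^ δ) ≤
      C1 * b ^ (-(n:ℤ)) * ((n:ℝ) + 1) ^ δ / 4 := by
    intro n
    have e1 : b ^ (-((n + 1 : ℕ):ℤ)) = b ^ (-(n:ℤ)) * b⁻¹ := by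
      rw [← zpow_sub_one₀ hb0.ne']; congr 1; push_cast; ring
    have e2 : (((n + 1 : ℕ):ℝ) + 1) ^ δ ≤ 2 ^ δ * ((n:ℝ) + 1) ^ δ := by
      rw [← Real.mul_rpow (by norm_num) (by positivity)]
      apply Real.rpow_le_rpow (by positivity) _ hδ.le
      push_cast; linarith [(Nat.cast_nonneg n : (0:ℝ) ≤ n)]
    have e3 : b⁻¹ * (a * 2 ^ δ) = 1 / 4 := by
      rw [hb]; field_simp
    rw [e1]
    calc a * (C1 * (b ^ (-(n:ℤ)) * b⁻¹) * (((n + 1 : ℕ):ℝ) + 1) ^ δ)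
        ≤ a * (C1 * (b ^ (-(n:ℤ)) * b⁻¹) * (2 ^ δ * ((n:ℝ) + 1) ^ δ)) := by gcongr
      _ = C1 * b ^ (-(n:ℤ)) * ((n:ℝ) + 1) ^ δ * (b⁻¹ * (a * 2 ^ δ)) := by ring
      _ = _ := by rw [e3]; ring
  induction j', h using Nat.le_induction with
  | base => exact step j
  | succ n hn ih =>
    refine (step n).trans (le_trans ?_ ih)
    have : 0 ≤ C1 * b ^ (-(n:ℤ)) * ((n:ℝ) + 1) ^ δ := by positivity
    nlinarith

lemma index_choice (b : ℝ) (hb : 2 ≤ b) (t : ℝ) (ht0 : 0 < t) (ht1 : t < 1) :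
    ∃ j : ℕ, b ^ (-(j:ℤ) - 1) ≤ t ∧ t ≤ b ^ (-(j:ℤ)) ∧ (j:ℝ) + 1 ≤ Real.logb 2 (2 / t) ∧
      Real.logb 2 (2 / t) ≤ ((j:ℝ) + 1) * (1 + Real.logb 2 b) := by
  have hb0 : 0 < b := by linarith
  have hb1 : 1 < b := by linarith
  obtain ⟨j, hj1, hj2⟩ := exists_nat_pow_near (x := 1 / t) (y := b)
    (by rw [le_div_iff₀ ht0]; linarith) hb1
  have h1 : b ^ (-(j:ℤ) - 1) ≤ t := by
    rw [show -(j:ℤ) - 1 = -((j + 1 : ℕ):ℤ) by push_cast; ring, zpow_neg, zpow_natCast,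
      inv_le_comm₀ (by positivity) ht0, ← one_div]
    exact hj2.le
  have h2 : t ≤ b ^ (-(j:ℤ)) := by
    rw [zpow_neg, zpow_natCast, le_inv_comm₀ ht0 (by positivity), ← one_div]
    exact hj1
  have hl : Real.logb 2 (2 / t) = 1 + Real.logb 2 (1 / t) := by
    rw [show 2 / t = 2 * (1 / t) by ring, Real.logb_mul (by norm_num) (by positivity)]
    simp
  have hlb : 1 ≤ Real.logb 2 b := by
    rw [Real.le_logb_iff_rpow_le (by norm_num) hb0]; simpa using hb
  have hlow : (j:ℝ) * Real.logb 2 b ≤ Real.logb 2 (1 / t) := by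
    rw [← Real.logb_pow]
    exact Real.logb_le_logb_of_le (by norm_num) (by positivity) hj1
  have hup : Real.logb 2 (1 / t) ≤ ((j:ℝ) + 1) * Real.logb 2 b := by
    have := Real.logb_le_logb_of_le (b := 2) (by norm_num) (by positivity) hj2.le
    rw [Real.logb_pow] at this
    push_cast at this
    exact this
  have hj0 : (0:ℝ) ≤ j := Nat.cast_nonneg j
  refine ⟨j, h1, h2, ?_, ?_⟩
  · rw [hl]; nlinarith
  · rw [hl]; nlinarith

lemma d_nonneg (d : X → X → ℝ) (a_d : ℝ) (had : 1 ≤ a_d)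
    (hd0 : ∀ x y, d x y = 0 ↔ x = y)
    (hdsymm : ∀ x y, d x y = d y x)
    (hdtri : ∀ x y z, d x y ≤ a_d * (d x z + d z y)) (x y : X) : 0 ≤ d x y := by
  have h := hdtri x x y
  rw [(hd0 x x).2 rfl, ← hdsymm x y] at h
  by_contra hc
  push Not at hc
  nlinarith

lemma ball_upper [TopologicalSpace X] [CompactSpace X] [MeasurableSpace X]
    (d : X → X → ℝ) (μ : Measure X) (γ c : ℝ) (hγ : 0 < γ) (hc : 0 < c)
    (hμ : ∀ (x : X) (t : ℝ), 0 < t → t ≤ 1 → μ (qball d x t) ≤ ENNReal.ofReal (c * t ^ γ))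
    (hbasis : ∀ x : X, (nhds x).HasBasis (fun t : ℝ => 0 < t) (fun t => qball d x t)) :
    μ univ ≠ ⊤ ∧ ∃ c' : ℝ, 0 < c' ∧
      ∀ (x : X) (t : ℝ), 0 < t → μ (qball d x t) ≤ ENNReal.ofReal (c' * t ^ γ) := by
  have hfin : μ univ < ⊤ := by
    refine isCompact_univ.measure_lt_top_of_nhdsWithin fun x _ => ?_
    exact ⟨qball d x 1, mem_nhdsWithin_of_mem_nhds ((hbasis x).mem_of_mem one_pos),
      (hμ x 1 one_pos le_rfl).trans_lt ENNReal.ofReal_lt_top⟩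
  refine ⟨hfin.ne, c + (μ univ).toReal, by positivity, fun x t ht => ?_⟩
  rcases le_or_gt t 1 with h1 | h1
  · refine (hμ x t ht h1).trans (ENNReal.ofReal_le_ofReal ?_)
    gcongr
    simp
  · refine (measure_mono (subset_univ _)).trans ?_
    rw [← ENNReal.ofReal_toReal hfin.ne]
    refine ENNReal.ofReal_le_ofReal ?_
    have h2 : (1:ℝ) ≤ t ^ γ := Real.one_le_rpow h1.le hγ.le
    rw [ENNReal.toReal_ofReal ENNReal.toReal_nonneg]
    nlinarith [ENNReal.toReal_nonneg (a := μ univ)]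

lemma unif_radius [TopologicalSpace X]
    (d : X → X → ℝ) (a_d : ℝ) (had : 1 ≤ a_d)
    (hdtri : ∀ x y z, d x y ≤ a_d * (d x z + d z y))
    (hbasis : ∀ x : X, (nhds x).HasBasis (fun t : ℝ => 0 < t) (fun t => qball d x t))
    (G : Set X) (hG : IsOpen G) (K : Set X) (hK : IsCompact K) (hKG : K ⊆ G) :
    ∃ ρ : ℝ, 0 < ρ ∧ ∀ x ∈ K, qball d x ρ ⊆ G := by
  refine hK.induction_on (p := fun s => ∃ ρ : ℝ, 0 < ρ ∧ ∀ x ∈ s, qball d x ρ ⊆ G) ?_ ?_ ?_ ?_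
  · exact ⟨1, one_pos, by simp⟩
  · rintro s t hst ⟨ρ, h0, h⟩
    exact ⟨ρ, h0, fun x hx => h x (hst hx)⟩
  · rintro s t ⟨ρ, h0, h⟩ ⟨ρ', h0', h'⟩
    refine ⟨min ρ ρ', lt_min h0 h0', fun x hx => ?_⟩
    rcases hx with hx | hx
    · exact Subset.trans (fun z (hz : d x z < _) => hz.trans_le (min_le_left _ _)) (h x hx)
    · exact Subset.trans (fun z (hz : d x z < _) => hz.trans_le (min_le_right _ _)) (h' x hx)
  · intro x hx
    obtain ⟨r, hr, hrG⟩ := (hbasis x).mem_iff.1 (hG.mem_nhds (hKG hx))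
    have hr2 : 0 < r / (2 * a_d) := by positivity
    refine ⟨qball d x (r / (2 * a_d)),
      mem_nhdsWithin_of_mem_nhds ((hbasis x).mem_of_mem hr2), r / (2 * a_d), hr2, ?_⟩
    intro y hy z hz
    apply hrG
    have hy : d x y < r / (2 * a_d) := hy
    have hz : d y z < r / (2 * a_d) := hz
    show d x z < r
    calc d x z ≤ a_d * (d x y + d y z) := hdtri x z y
      _ < a_d * (r / (2 * a_d) + r / (2 * a_d)) := by gcongr
      _ = r := by field_simp; ring

lemma apply_k [MeasurableSpace X] (d : X → X → ℝ) (a : ℝ) (ha : 1 ≤ a)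
    (hself : ∀ x, d x x = 0)
    (hdsymm : ∀ x y, d x y = d y x)
    (hdtri : ∀ x y z, d x y ≤ a * (d x z + d z y))
    (μ ν : Measure X) (hν : ν ≤ μ) (γ c : ℝ) (hγ : 0 < γ) (hc : 0 < c)
    (hμ : ∀ (x : X) (t : ℝ), 0 < t → μ (qball d x t) ≤ ENNReal.ofReal (c * t ^ γ))
    (p : ℝ) (hp : 1 < p) (δ : ℝ) (hδ : δ = p / γ)
    (g : X → ℝ≥0∞) (hgm : Measurable g) (hg : ∫⁻ z, g z ∂ν ≠ ⊤)
    (b C1 : ℝ) (hb : b = 4 * a * 2 ^ δ) (hC1 : 8 * a ^ 2 ≤ C1) (k : ℕ) :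
    ∃ Φ : X → ℝ≥0∞, Measurable Φ ∧
      ∫⁻ x, Φ x ∂μ ≤ (Ccore a γ c p * ENNReal.ofReal (C1 ^ γ) * ∫⁻ z, g z ^ p ∂ν) *
        ENNReal.ofReal ((b ^ (-γ)) ^ k) ∧
      ∀ x, ∀ j : ℕ, b ^ k ≤ ((j:ℝ) + 1) ^ δ → ∀ y, ∀ E : Set X, MeasurableSet E →
        E ⊆ qball d y (b ^ ((k:ℤ) - j)) → d x y < C1 * b ^ (-(j:ℤ)) * ((j:ℝ) + 1) ^ δ →
        ENNReal.ofReal ((b ^ ((k:ℤ) - j)) ^ (-γ)) * (∫⁻ z in E, g z ∂ν) ≤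
          ENNReal.ofReal ((j:ℝ) + 1) * Φ x ^ (1 / p) := by
  have hδ0 : 0 < δ := by rw [hδ]; positivity
  have h2δ : 0 < (2:ℝ) ^ δ := by positivity
  have hb0 : 0 < b := by rw [hb]; positivity
  have hC10 : 0 < C1 := by nlinarith
  have hC11 : 1 ≤ C1 := by nlinarith
  have hsplit : ∀ j : ℕ, b ^ ((k:ℤ) - j) = b ^ k * b ^ (-(j:ℤ)) := by
    intro j
    rw [sub_eq_add_neg, zpow_add₀ hb0.ne', zpow_natCast]
  have hle : ∀ j : ℕ, b ^ k ≤ ((j:ℝ) + 1) ^ δ →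
      b ^ ((k:ℤ) - j) ≤ b ^ (-(j:ℤ)) * ((j:ℝ) + 1) ^ δ := by
    intro j hj
    rw [hsplit, mul_comm]
    gcongr
  have hC0pos : 0 < C1 ^ γ * (b ^ (-γ)) ^ k := by positivity
  refine Exists.elim (core d a ha hself hdsymm hdtri μ ν hν γ c hc hμ p hp g hgm hg
    (fun j => b ^ ((k:ℤ) - j)) (fun j => C1 * b ^ (-(j:ℤ)) * ((j:ℝ) + 1) ^ δ)
    (fun j => (j:ℝ) + 1) (fun j => by positivity) (fun j => by positivity)
    (fun i j h => by simpa using h) {j | b ^ k ≤ ((j:ℝ) + 1) ^ δ} ?_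
    (C1 ^ γ * (b ^ (-γ)) ^ k) hC0pos ?_ ?_) ?_
  rotate_left 3
  · rintro Φ ⟨h1, h2, h3⟩
    refine ⟨Φ, h1, ?_, fun x j hj y E => h3 x j hj y E⟩
    refine h2.trans (le_of_eq ?_)
    rw [ENNReal.ofReal_mul (by positivity)]
    ring
  · intro j hj
    refine (hle j hj).trans ?_
    show b ^ (-(j:ℤ)) * ((j:ℝ) + 1) ^ δ ≤ C1 * b ^ (-(j:ℤ)) * ((j:ℝ) + 1) ^ δ
    have : 0 < b ^ (-(j:ℤ)) * ((j:ℝ) + 1) ^ δ := by positivity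
    nlinarith
  · intro j hj
    show (C1 * b ^ (-(j:ℤ)) * ((j:ℝ) + 1) ^ δ) ^ γ ≤
      C1 ^ γ * (b ^ (-γ)) ^ k * ((j:ℝ) + 1) ^ p * (b ^ ((k:ℤ) - j)) ^ γ
    rw [hsplit, Real.mul_rpow (by positivity) (by positivity),
      Real.mul_rpow (by positivity) (by positivity),
      Real.mul_rpow (by positivity) (by positivity), ← Real.rpow_mul (by positivity),
      show δ * γ = p by rw [hδ]; field_simp]
    have e : (b ^ (-γ)) ^ k * (b ^ k) ^ γ = 1 := by
      rw [← Real.rpow_natCast b k, ← Real.rpow_mul hb0.le, mul_comm (k:ℝ), Real.rpow_mul hb0.le,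
        Real.rpow_natCast, ← mul_pow, ← Real.rpow_add hb0]
      simp
    apply le_of_eq
    linear_combination (-(C1 ^ γ * ((j:ℝ) + 1) ^ p * (b ^ (-(j:ℤ))) ^ γ)) * e
  · intro j hj j' hj' hjj
    have e1 := R_step δ a b hδ0 ha hb C1 hC10 j j' hjj
    have e2 := hle j hj
    have e3 := hle j' hj'
    have e4 := R_step δ a b hδ0 ha hb 1 one_pos j j' hjj
    have pj : 0 < b ^ (-(j:ℤ)) * ((j:ℝ) + 1) ^ δ := by positivity
    have pj' : 0 < b ^ (-(j':ℤ)) * ((j':ℝ) + 1) ^ δ := by positivity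
    show a * (C1 * b ^ (-(j':ℤ)) * ((j':ℝ) + 1) ^ δ) + a ^ 2 * (b ^ ((k:ℤ) - j) + b ^ ((k:ℤ) - j')) ≤
      C1 * b ^ (-(j:ℤ)) * ((j:ℝ) + 1) ^ δ
    have e5 : b ^ ((k:ℤ) - j) + b ^ ((k:ℤ) - j') ≤ 2 * (b ^ (-(j:ℤ)) * ((j:ℝ) + 1) ^ δ) := by
      nlinarith
    have e6 : a ^ 2 * (b ^ ((k:ℤ) - j) + b ^ ((k:ℤ) - j')) ≤
        a ^ 2 * (2 * (b ^ (-(j:ℤ)) * ((j:ℝ) + 1) ^ δ)) := by gcongr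
    have e7 := mul_le_mul_of_nonneg_right hC1 pj.le
    nlinarith

lemma apply_M [MeasurableSpace X] (d : X → X → ℝ) (a : ℝ) (ha : 1 ≤ a)
    (hself : ∀ x, d x x = 0)
    (hdsymm : ∀ x y, d x y = d y x)
    (hdtri : ∀ x y z, d x y ≤ a * (d x z + d z y))
    (μ ν : Measure X) (hν : ν ≤ μ) (γ c : ℝ) (hc : 0 < c)
    (hμ : ∀ (x : X) (t : ℝ), 0 < t → μ (qball d x t) ≤ ENNReal.ofReal (c * t ^ γ))
    (p : ℝ) (hp : 1 < p)
    (g : X → ℝ≥0∞) (hgm : Measurable g) (hg : ∫⁻ z, g z ∂ν ≠ ⊤)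
    (b C1 : ℝ) (hb : 4 * a ≤ b) (hC1 : 8 * a ^ 2 ≤ C1) :
    ∃ Φ : X → ℝ≥0∞, Measurable Φ ∧
      ∫⁻ x, Φ x ∂μ ≤ (Ccore a γ c p * ENNReal.ofReal (C1 ^ γ) * ∫⁻ z, g z ^ p ∂ν) ∧
      ∀ x, ∀ j : ℕ, ∀ y, ∀ E : Set X, MeasurableSet E →
        E ⊆ qball d y (b ^ (-(j:ℤ))) → d x y < C1 * b ^ (-(j:ℤ)) →
        ENNReal.ofReal ((b ^ (-(j:ℤ))) ^ (-γ)) * (∫⁻ z in E, g z ∂ν) ≤ Φ x ^ (1 / p) := by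
  have hb0 : 0 < b := by linarith
  have hb1 : 1 ≤ b := by linarith
  have hC10 : 0 < C1 := by nlinarith
  have hC11 : 1 ≤ C1 := by nlinarith
  refine Exists.elim (core d a ha hself hdsymm hdtri μ ν hν γ c hc hμ p hp g hgm hg
    (fun j => b ^ (-(j:ℤ))) (fun j => C1 * b ^ (-(j:ℤ)))
    (fun _ => 1) (fun j => by positivity) (fun j => by positivity)
    (fun i j h => le_rfl) univ ?_ (C1 ^ γ) (by positivity) ?_ ?_) ?_
  rotate_left 3
  · rintro Φ ⟨h1, h2, h3⟩
    refine ⟨Φ, h1, h2, fun x j y E hE hs hxy => ?_⟩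
    simpa using h3 x j (mem_univ _) y E hE hs hxy
  · intro j _
    show b ^ (-(j:ℤ)) ≤ C1 * b ^ (-(j:ℤ))
    have : 0 < b ^ (-(j:ℤ)) := by positivity
    nlinarith
  · intro j _
    show (C1 * b ^ (-(j:ℤ))) ^ γ ≤ C1 ^ γ * 1 ^ p * (b ^ (-(j:ℤ))) ^ γ
    rw [Real.mul_rpow (by positivity) (by positivity)]
    simp
  · intro j _ j' _ hjj
    show a * (C1 * b ^ (-(j':ℤ))) + a ^ 2 * (b ^ (-(j:ℤ)) + b ^ (-(j':ℤ))) ≤ C1 * b ^ (-(j:ℤ))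
    have pj : 0 < b ^ (-(j:ℤ)) := by positivity
    have pj' : 0 < b ^ (-(j':ℤ)) := by positivity
    have e1 : b ^ (-(j':ℤ)) * b ≤ b ^ (-(j:ℤ)) := by
      rw [← zpow_add_one₀ hb0.ne']
      exact zpow_le_zpow_right₀ hb1 (by omega)
    have e2 : 4 * (a * b ^ (-(j':ℤ))) ≤ b ^ (-(j:ℤ)) := by nlinarith
    have e3 : b ^ (-(j':ℤ)) ≤ b ^ (-(j:ℤ)) := by nlinarith
    have e4 := mul_le_mul_of_nonneg_right hC1 pj.le
    have e5 := mul_le_mul_of_nonneg_left e2 hC10.le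
    have e6 : a ^ 2 * b ^ (-(j':ℤ)) ≤ a ^ 2 * b ^ (-(j:ℤ)) := by gcongr
    nlinarith

lemma pointwise [MeasurableSpace X] (d : X → X → ℝ) (a : ℝ) (ha : 1 ≤ a)
    (hd : ∀ x y, 0 ≤ d x y)
    (hdtri : ∀ x y z, d x y ≤ a * (d x z + d z y))
    (μ : Measure X) (γ : ℝ) (hγ : 0 < γ) (p : ℝ) (δ : ℝ) (hδ : 0 < δ)
    (g : X → ℝ≥0∞) (hgm : Measurable g) (G : Set X)
    (b C1 : ℝ) (hb : 2 ≤ b) (hC1 : (1 + Real.logb 2 b) ^ δ ≤ C1)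
    (i0 : ℕ) (ρ : ℝ)
    (hi0 : ∀ j : ℕ, i0 ≤ j → a * (C1 * b ^ (-(j:ℤ)) * ((j:ℝ) + 1) ^ δ + b ^ (-(i0:ℤ))) ≤ ρ)
    (Φ : ℕ → X → ℝ≥0∞) (ΦM : X → ℝ≥0∞)
    (hΦ : ∀ k : ℕ, ∀ x, ∀ j : ℕ, b ^ k ≤ ((j:ℝ) + 1) ^ δ → ∀ y, ∀ E : Set X, MeasurableSet E →
        E ⊆ qball d y (b ^ ((k:ℤ) - j)) → d x y < C1 * b ^ (-(j:ℤ)) * ((j:ℝ) + 1) ^ δ →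
        ENNReal.ofReal ((b ^ ((k:ℤ) - j)) ^ (-γ)) * (∫⁻ z in E, g z ∂(μ.restrict G)) ≤
          ENNReal.ofReal ((j:ℝ) + 1) * Φ k x ^ (1 / p))
    (hΦM : ∀ x, ∀ j : ℕ, ∀ y, ∀ E : Set X, MeasurableSet E →
        E ⊆ qball d y (b ^ (-(j:ℤ))) → d x y < C1 * b ^ (-(j:ℤ)) →
        ENNReal.ofReal ((b ^ (-(j:ℤ))) ^ (-γ)) * (∫⁻ z in E, g z ∂(μ.restrict G)) ≤ ΦM x ^ (1 / p))
    (x : X) (hx : qball d x ρ ⊆ G) (y : X) (t : ℝ) (ht0 : 0 < t) (ht1 : t < 1)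
    (hxy : d x y < t * (Real.logb 2 (2 / t)) ^ δ) :
    (ENNReal.ofReal (Real.logb 2 (2 / t)))⁻¹ * ∫⁻ z, g z / ENNReal.ofReal ((d y z + t) ^ γ) ∂μ ≤
      ENNReal.ofReal ((b ^ (-(i0:ℤ))) ^ (-γ)) * (∫⁻ z, g z ∂μ) +
        ENNReal.ofReal (b ^ γ) * ((∑' k, Φ k x ^ (1 / p)) + ΦM x ^ (1 / p)) := by
  have hb0 : 0 < b := by linarith
  have hb1 : 1 < b := by linarith
  obtain ⟨j, hj1, hj2, hL1, hL2⟩ := index_choice b hb t ht0 ht1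
  set L := Real.logb 2 (2 / t) with hL
  have hj0 : (0:ℝ) ≤ j := Nat.cast_nonneg j
  have hL0 : 0 < L := by linarith
  have hLinv : (ENNReal.ofReal L)⁻¹ ≤ 1 := by
    rw [ENNReal.inv_le_one]
    exact ENNReal.one_le_ofReal.2 (by linarith)
  have hlb : 0 ≤ Real.logb 2 b := Real.logb_nonneg (by norm_num) (by linarith)
  have hxyR : d x y < C1 * b ^ (-(j:ℤ)) * ((j:ℝ) + 1) ^ δ := by
    refine hxy.trans_le ?_
    calc t * L ^ δ ≤ b ^ (-(j:ℤ)) * (((j:ℝ) + 1) * (1 + Real.logb 2 b)) ^ δ := by gcongr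
      _ = (1 + Real.logb 2 b) ^ δ * b ^ (-(j:ℤ)) * ((j:ℝ) + 1) ^ δ := by
        rw [Real.mul_rpow (by positivity) (by positivity)]; ring
      _ ≤ _ := by gcongr
  rcases lt_or_ge j i0 with hji | hji
  · refine le_trans ?_ le_self_add
    refine (mul_le_mul_left hLinv _).trans ?_
    rw [one_mul, ← lintegral_const_mul _ hgm]
    refine lintegral_mono fun z => kernel_le _ _ γ hγ (by positivity) ?_ _
    have : b ^ (-(i0:ℤ)) ≤ b ^ (-(j:ℤ) - 1) := zpow_le_zpow_right₀ hb1.le (by omega)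
    linarith [hd y z]
  · obtain ⟨E, hEm, hEs, hE⟩ := kernel_decomp d hd μ γ hγ g hgm b hb1 j i0 hji y t hj1
    refine (mul_le_mul_right hE _).trans ?_
    rw [mul_add]
    refine add_le_add ?_ ?_
    · exact (mul_le_mul_left hLinv _).trans (one_mul _).le
    · rw [mul_left_comm]
      refine mul_le_mul_right ?_ _
      have hterm : ∀ k ∈ Finset.range (j - i0 + 1),
          ENNReal.ofReal ((b ^ ((k:ℤ) - j)) ^ (-γ)) * ∫⁻ z in E k, g z ∂μ ≤
          ENNReal.ofReal ((j:ℝ) + 1) * Φ k x ^ (1 / p) + ΦM x ^ (1 / p) := by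
        intro k hk
        have hk : k + i0 ≤ j := by
          simp only [Finset.mem_range] at hk; omega
        have hEG : E k ⊆ G := by
          refine Subset.trans (fun z hz => ?_) hx
          have h1 : d y z < b ^ ((k:ℤ) - j) := hEs k hz
          have h2 : b ^ ((k:ℤ) - j) ≤ b ^ (-(i0:ℤ)) := zpow_le_zpow_right₀ hb1.le (by omega)
          have h3 := hdtri x z y
          have h4 := hi0 j hji
          show d x z < ρ
          nlinarith
        rw [← Measure.restrict_restrict_of_subset hEG]
        by_cases hbk : b ^ k ≤ ((j:ℝ) + 1) ^ δ
        · exact (hΦ k x j hbk y (E k) (hEm k) (hEs k) hxyR).trans le_self_add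
        · push Not at hbk
          have hs := hEs k
          rw [show (k:ℤ) - j = -((j - k : ℕ) : ℤ) by omega] at hs ⊢
          refine (hΦM x (j - k) y (E k) (hEm k) hs ?_).trans le_add_self
          refine hxyR.trans_le ?_
          rw [show -((j - k : ℕ) : ℤ) = -(j:ℤ) + k by omega, zpow_add₀ hb0.ne', zpow_natCast,
            mul_assoc]
          have : 0 ≤ C1 := le_trans (by positivity) hC1
          gcongr
      refine (mul_le_mul_right (Finset.sum_le_sum hterm) _).trans ?_
      rw [Finset.sum_add_distrib, ← Finset.mul_sum, Finset.sum_const, Finset.card_range,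
        nsmul_eq_mul]
      have h5 : (((j - i0 + 1 : ℕ)) : ℝ≥0∞) ≤ ENNReal.ofReal L := by
        rw [← ENNReal.ofReal_natCast]
        refine ENNReal.ofReal_le_ofReal (le_trans ?_ hL1)
        exact_mod_cast (by omega : j - i0 + 1 ≤ j + 1)
      have h6 : ENNReal.ofReal ((j:ℝ) + 1) ≤ ENNReal.ofReal L := ENNReal.ofReal_le_ofReal hL1
      have hLne : ENNReal.ofReal L ≠ 0 := by simpa using hL0
      calc (ENNReal.ofReal L)⁻¹ * (ENNReal.ofReal ((j:ℝ) + 1) *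
              (∑ k ∈ Finset.range (j - i0 + 1), Φ k x ^ (1 / p)) +
              ((j - i0 + 1 : ℕ) : ℝ≥0∞) * ΦM x ^ (1 / p))
          ≤ (ENNReal.ofReal L)⁻¹ * (ENNReal.ofReal L * (∑' k, Φ k x ^ (1 / p)) +
              ENNReal.ofReal L * ΦM x ^ (1 / p)) := by
            gcongr
            exact ENNReal.sum_le_tsum _
        _ = _ := by
            rw [← mul_add, ← mul_assoc, ENNReal.inv_mul_cancel hLne ENNReal.ofReal_ne_top, one_mul]

lemma choose_i0 (δ a b : ℝ) (hδ : 0 < δ) (ha : 1 ≤ a) (hb : b = 4 * a * 2 ^ δ) (C1 : ℝ) (hC1 : 0 < C1)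
    (ρ : ℝ) (hρ : 0 < ρ) : ∃ i0 : ℕ, ∀ j : ℕ, i0 ≤ j →
      a * (C1 * b ^ (-(j:ℤ)) * ((j:ℝ) + 1) ^ δ + b ^ (-(i0:ℤ))) ≤ ρ := by
  have h2δ : (1:ℝ) ≤ 2 ^ δ := Real.one_le_rpow (by norm_num) hδ.le
  have hb0 : 0 < b := by rw [hb]; positivity
  have hb4 : 4 ≤ b := by rw [hb]; nlinarith
  have hR : ∀ j : ℕ, C1 * b ^ (-(j:ℤ)) * ((j:ℝ) + 1) ^ δ ≤ C1 * (1 / 4) ^ j := by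
    intro j
    induction j with
    | zero => simp
    | succ n ih =>
      have h := R_step δ a b hδ ha hb C1 hC1 n (n + 1) (by omega)
      have h0 : 0 < C1 * b ^ (-((n + 1 : ℕ):ℤ)) * (((n + 1 : ℕ):ℝ) + 1) ^ δ := by positivity
      rw [pow_succ]
      nlinarith
  obtain ⟨i0, hi0⟩ := exists_pow_lt_of_lt_one (x := ρ / (a * (C1 + 1))) (y := (1 / 4 : ℝ))
    (by positivity) (by norm_num)
  refine ⟨i0, fun j hj => ?_⟩
  have h1 : b ^ (-(i0:ℤ)) ≤ (1 / 4) ^ i0 := by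
    rw [zpow_neg, zpow_natCast, ← inv_pow, one_div]
    gcongr
  have h2 : (1 / 4 : ℝ) ^ j ≤ (1 / 4) ^ i0 := pow_le_pow_of_le_one (by norm_num) (by norm_num) hj
  rw [lt_div_iff₀ (by positivity)] at hi0
  calc a * (C1 * b ^ (-(j:ℤ)) * ((j:ℝ) + 1) ^ δ + b ^ (-(i0:ℤ)))
      ≤ a * (C1 * (1 / 4) ^ i0 + (1 / 4) ^ i0) := by
        have h3 : C1 * b ^ (-(j:ℤ)) * ((j:ℝ) + 1) ^ δ ≤ C1 * (1 / 4) ^ i0 :=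
          (hR j).trans (mul_le_mul_of_nonneg_left h2 hC1.le)
        exact mul_le_mul_of_nonneg_left (add_le_add h3 h1) (by linarith)
    _ = (1 / 4) ^ i0 * (a * (C1 + 1)) := by ring
    _ ≤ ρ := hi0.le

lemma final_int [MeasurableSpace X] (μ : Measure X) (p : ℝ) (hp : 1 < p)
    (q B : ℝ≥0∞) (S M : X → ℝ≥0∞) (hS : Measurable S) (hM : Measurable M) :
    ∫⁻ x, (q + B * (S x + M x ^ (1 / p))) ^ p ∂μ ≤
      2 ^ (p - 1) * (q ^ p * μ univ +
        B ^ p * (2 ^ (p - 1) * (∫⁻ x, S x ^ p ∂μ + ∫⁻ x, M x ∂μ))) := by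
  have hp0 : 0 < p := by linarith
  have hpt : ∀ x, (q + B * (S x + M x ^ (1 / p))) ^ p ≤
      2 ^ (p - 1) * (q ^ p + B ^ p * (2 ^ (p - 1) * (S x ^ p + M x))) := by
    intro x
    refine (ENNReal.rpow_add_le_mul_rpow_add_rpow _ _ hp.le).trans ?_
    refine mul_le_mul_right (add_le_add_right ?_ _) _
    rw [ENNReal.mul_rpow_of_nonneg _ _ hp0.le]
    refine mul_le_mul_right ?_ _
    refine (ENNReal.rpow_add_le_mul_rpow_add_rpow _ _ hp.le).trans ?_
    rw [← ENNReal.rpow_mul, one_div_mul_cancel hp0.ne', ENNReal.rpow_one]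
  refine (lintegral_mono hpt).trans (le_of_eq ?_)
  have hSp : Measurable fun x => S x ^ p := hS.pow_const p
  rw [lintegral_const_mul _ (by fun_prop), lintegral_add_left measurable_const, lintegral_const,
    lintegral_const_mul _ (by fun_prop), lintegral_const_mul _ (by fun_prop), lintegral_add_left hSp]

/-- Local form of the strong type inequality: for `K` compact inside an open set
`G`, `‖ℒ_δ(𝒫₀f)‖_{L^p(K)} ≤ c_p(K)(‖f‖_{L¹(X)} + ‖f‖_{L^p(G)})`. -/
theorem local_strong_type_inequality_for_P0
    [TopologicalSpace X] [CompactSpace X]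
    [MeasurableSpace X]
    (d : X → X → ℝ) (a_d : ℝ) (had : 1 ≤ a_d)
    (hd0 : ∀ x y, d x y = 0 ↔ x = y)
    (hdsymm : ∀ x y, d x y = d y x)
    (hdtri : ∀ x y z, d x y ≤ a_d * (d x z + d z y))
    (hdiam : ∀ x y, d x y ≤ 1)
    (μ : Measure X) (γ c : ℝ) (hγ : 0 < γ) (hc : 0 < c)
    (hμ : ∀ (x : X) (t : ℝ), 0 < t → t ≤ 1 →
      ENNReal.ofReal (c⁻¹ * t ^ γ) ≤ μ (qball d x t) ∧
      μ (qball d x t) ≤ ENNReal.ofReal (c * t ^ γ))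
    (hbasis : ∀ x : X, (nhds x).HasBasis (fun t : ℝ => 0 < t) (fun t => qball d x t))
    (p : ℝ) (hp : 1 < p) (δ : ℝ) (hδ : δ = p / γ)
    (G : Set X) (hG : IsOpen G) :
    ∀ K : Set X, IsCompact K → K ⊆ G →
      ∃ c_pK : ℝ, 0 < c_pK ∧ ∀ (f : X → ℝ), MeasureTheory.Integrable f μ →
        (∫⁻ x in K, (Ltan d δ (P0 d μ γ f) x) ^ p ∂μ) ^ (1 / p) ≤
          ENNReal.ofReal c_pK *
            ((∫⁻ x, ENNReal.ofReal |f x| ∂μ) +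
              (∫⁻ x in G, ENNReal.ofReal |f x| ^ p ∂μ) ^ (1 / p)) := by
  intro K hK hKG
  have hp0 : 0 < p := by linarith
  have hδ0 : 0 < δ := by rw [hδ]; positivity
  have hself : ∀ x, d x x = 0 := fun x => (hd0 x x).2 rfl
  have hd := d_nonneg d a_d had hd0 hdsymm hdtri
  obtain ⟨hfin, c', hc', hμ'⟩ := ball_upper d μ γ c hγ hc (fun x t h0 h1 => (hμ x t h0 h1).2) hbasis
  obtain ⟨ρ, hρ, hρG⟩ := unif_radius d a_d had hdtri hbasis G hG K hK hKG
  obtain ⟨b, hb⟩ : ∃ b, b = 4 * a_d * 2 ^ δ := ⟨_, rfl⟩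
  have h2δ : (1:ℝ) ≤ 2 ^ δ := Real.one_le_rpow (by norm_num) hδ0.le
  have hb4 : 4 * a_d ≤ b := by rw [hb]; nlinarith
  have hb2 : 2 ≤ b := by linarith
  have hb0 : 0 < b := by linarith
  have hlb : 0 ≤ Real.logb 2 b := Real.logb_nonneg (by norm_num) (by linarith)
  obtain ⟨C1, hC1⟩ : ∃ C1, C1 = 8 * a_d ^ 2 * (1 + Real.logb 2 b) ^ δ := ⟨_, rfl⟩
  have hlδ : 1 ≤ (1 + Real.logb 2 b) ^ δ := Real.one_le_rpow (by linarith) hδ0.le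
  have hC1a : 8 * a_d ^ 2 ≤ C1 := by rw [hC1]; nlinarith
  have hC1b : (1 + Real.logb 2 b) ^ δ ≤ C1 := by
    have h8 : 1 ≤ 8 * a_d ^ 2 := by nlinarith
    rw [hC1]; nlinarith
  have hC10 : 0 < C1 := by linarith
  obtain ⟨i0, hi0⟩ := choose_i0 δ a_d b hδ0 had hb C1 hC10 ρ hρ
  obtain ⟨Cs, hCs, hsum⟩ := sum_dom μ p hp (b ^ (-γ)) (by positivity)
    (Real.rpow_lt_one_of_one_lt_of_neg (by linarith) (by linarith))
  obtain ⟨Cc, hCc⟩ : ∃ Cc, Cc = Ccore a_d γ c' p * ENNReal.ofReal (C1 ^ γ) := ⟨_, rfl⟩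
  have hCct : Cc ≠ ⊤ := by
    rw [hCc]
    exact ENNReal.mul_ne_top (Ccore_ne_top _ _ _ _ hp) ENNReal.ofReal_ne_top
  obtain ⟨κ, hκ⟩ : ∃ κ, κ = ENNReal.ofReal ((b ^ (-(i0:ℤ))) ^ (-γ)) := ⟨_, rfl⟩
  obtain ⟨B, hB⟩ : ∃ B, B = ENNReal.ofReal (b ^ γ) := ⟨_, rfl⟩
  have hκt : κ ≠ ⊤ := by rw [hκ]; exact ENNReal.ofReal_ne_top
  have hBt : B ≠ ⊤ := by rw [hB]; exact ENNReal.ofReal_ne_top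
  have h2t : (2:ℝ≥0∞) ^ (p - 1) ≠ ⊤ := ENNReal.rpow_ne_top_of_nonneg (by linarith) (by norm_num)
  obtain ⟨D1, hD1⟩ : ∃ D1, D1 = 2 ^ (p - 1) * (κ ^ p * μ univ) := ⟨_, rfl⟩
  obtain ⟨D2, hD2⟩ : ∃ D2, D2 = 2 ^ (p - 1) * (B ^ p * (2 ^ (p - 1) * ((Cs + 1) * Cc))) := ⟨_, rfl⟩
  have hD1t : D1 ≠ ⊤ := by
    rw [hD1]
    exact ENNReal.mul_ne_top h2t (ENNReal.mul_ne_top (ENNReal.rpow_ne_top_of_nonneg hp0.le hκt) hfin)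
  have hD2t : D2 ≠ ⊤ := by
    rw [hD2]
    exact ENNReal.mul_ne_top h2t (ENNReal.mul_ne_top (ENNReal.rpow_ne_top_of_nonneg hp0.le hBt)
      (ENNReal.mul_ne_top h2t (ENNReal.mul_ne_top (ENNReal.add_ne_top.2 ⟨hCs, ENNReal.one_ne_top⟩) hCct)))
  have hinv : 0 ≤ 1 / p := by positivity
  have hD1p : D1 ^ (1 / p) ≠ ⊤ := ENNReal.rpow_ne_top_of_nonneg hinv hD1t
  have hD2p : D2 ^ (1 / p) ≠ ⊤ := ENNReal.rpow_ne_top_of_nonneg hinv hD2t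
  have hDp : D1 ^ (1 / p) + D2 ^ (1 / p) ≠ ⊤ := ENNReal.add_ne_top.2 ⟨hD1p, hD2p⟩
  refine ⟨(D1 ^ (1 / p) + D2 ^ (1 / p)).toReal + 1, by positivity, fun f hf => ?_⟩
  -- a measurable representative of the modulus of the function
  have hfa : AEMeasurable (fun x => ENNReal.ofReal |f x|) μ :=
    (hf.abs.aestronglyMeasurable.aemeasurable).ennreal_ofReal
  obtain ⟨g, hgm, hgeq⟩ := hfa
  have hgeqG : (fun x => ENNReal.ofReal |f x|) =ᵐ[μ.restrict G] g := ae_restrict_of_ae hgeq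
  have hN1 : ∫⁻ x, ENNReal.ofReal |f x| ∂μ = ∫⁻ x, g x ∂μ := lintegral_congr_ae hgeq
  have hNp : ∫⁻ x in G, ENNReal.ofReal |f x| ^ p ∂μ = ∫⁻ x in G, g x ^ p ∂μ := by
    refine lintegral_congr_ae ?_
    filter_upwards [hgeqG] with x hx
    rw [hx]
  have hgfin : ∫⁻ x, g x ∂μ ≠ ⊤ := by
    rw [← hN1]
    have := hf.hasFiniteIntegral
    rw [hasFiniteIntegral_iff_norm] at this
    exact this.ne
  have hgfinG : ∫⁻ x, g x ∂(μ.restrict G) ≠ ⊤ :=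
    ne_top_of_le_ne_top hgfin (lintegral_mono' Measure.restrict_le_self le_rfl)
  rw [hN1, hNp]
  set N1 := ∫⁻ x, g x ∂μ with hN1d
  set Np := ∫⁻ x in G, g x ^ p ∂μ with hNpd
  have hk := fun k => apply_k d a_d had hself hdsymm hdtri μ (μ.restrict G) Measure.restrict_le_self γ c'
    hγ hc' hμ' p hp δ hδ g hgm hgfinG b C1 hb hC1a k
  choose Φ hΦm hΦi hΦ using hk
  obtain ⟨ΦM, hΦMm, hΦMi, hΦM⟩ := apply_M d a_d had hself hdsymm hdtri μ (μ.restrict G)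
    Measure.restrict_le_self γ c' hc' hμ' p hp g hgm hgfinG b C1 hb4 hC1a
  rw [← hCc] at hΦMi
  simp only [← hCc] at hΦi
  have hSm : Measurable fun x => ∑' k, Φ k x ^ (1 / p) :=
    Measurable.tsum fun k => (hΦm k).pow_const _
  have hpw : ∀ x ∈ K, Ltan d δ (P0 d μ γ f) x ≤
      κ * N1 + B * ((∑' k, Φ k x ^ (1 / p)) + ΦM x ^ (1 / p)) := by
    intro x hx
    unfold Ltan
    refine iSup_le fun y => iSup_le fun t => iSup_le fun ht0 => iSup_le fun ht1 => iSup_le fun hxy => ?_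
    have h := pointwise d a_d had hd hdtri μ γ hγ p δ hδ0 g hgm G b C1 hb2 hC1b i0 ρ hi0 Φ ΦM hΦ hΦM
      x (hρG x hx) y t ht0 ht1 hxy
    rw [hκ, hB]
    refine le_trans (le_of_eq ?_) h
    unfold P0
    congr 1
    refine lintegral_congr_ae ?_
    filter_upwards [hgeq] with z hz
    rw [hz]
  have h_integral : ∫⁻ x in K, (Ltan d δ (P0 d μ γ f) x) ^ p ∂μ ≤ D1 * N1 ^ p + D2 * Np := by
    have hΨm : Measurable fun x =>
        (κ * N1 + B * ((∑' k, Φ k x ^ (1 / p)) + ΦM x ^ (1 / p))) ^ p :=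
      (((hSm.add (hΦMm.pow_const _)).const_mul B).const_add _).pow_const _
    refine (setLIntegral_mono hΨm fun x hx => ENNReal.rpow_le_rpow (hpw x hx) hp0.le).trans ?_
    refine (lintegral_mono' Measure.restrict_le_self le_rfl).trans ?_
    refine (final_int μ p hp (κ * N1) B _ ΦM hSm hΦMm).trans ?_
    have hs := hsum Φ (Cc * Np) hΦm hΦi
    calc _ ≤ 2 ^ (p - 1) * ((κ * N1) ^ p * μ univ +
          B ^ p * (2 ^ (p - 1) * (Cs * (Cc * Np) + Cc * Np))) := by gcongr
      _ = D1 * N1 ^ p + D2 * Np := by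
        rw [ENNReal.mul_rpow_of_nonneg _ _ hp0.le, hD1, hD2]
        ring
  have hmain : (∫⁻ x in K, (Ltan d δ (P0 d μ γ f) x) ^ p ∂μ) ^ (1 / p) ≤
      D1 ^ (1 / p) * N1 + D2 ^ (1 / p) * Np ^ (1 / p) := by
    refine (ENNReal.rpow_le_rpow h_integral hinv).trans ?_
    refine (ENNReal.rpow_add_le_add_rpow _ _ hinv (by rw [div_le_one hp0]; exact hp.le)).trans
      (le_of_eq ?_)
    rw [ENNReal.mul_rpow_of_nonneg _ _ hinv, ENNReal.mul_rpow_of_nonneg _ _ hinv,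
      ← ENNReal.rpow_mul, mul_one_div_cancel hp0.ne', ENNReal.rpow_one]
  refine hmain.trans ?_
  have hcle : D1 ^ (1 / p) + D2 ^ (1 / p) ≤
      ENNReal.ofReal ((D1 ^ (1 / p) + D2 ^ (1 / p)).toReal + 1) := by
    rw [ENNReal.ofReal_add ENNReal.toReal_nonneg zero_le_one, ENNReal.ofReal_toReal hDp]
    exact le_self_add
  rw [mul_add]
  exact add_le_add (mul_le_mul_left (le_self_add.trans hcle) _)
    (mul_le_mul_left (le_add_self.trans hcle) _)
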